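/- Let Φ be a smooth volume-preserving asymmetric Anosov flow with generator X on a closed n-manifold M, and let 2 ≤ k ≤ n-2. Then the only continuous k-form ω with continuous L_X ω satisfying L_X ω = 0 is ω = 0; i.e. Inv^k(M,X) = {0}. -/

import Mathlib

open Manifold Filter Topology Metric RealInnerProductSpace

noncomputable section

/-- Euclidean model space. -/
abbrev Eu (d : ℕ) := EuclideanSpace ℝ (Fin d)

/-- Exterior `k`-forms on the `d`-dimensional Euclidean model space. -/
abbrev AltF (d k : ℕ) := AlternatingMap ℝ (Eu d) ℝ (Fin k)

/-- Differential `k`-forms on `M` (each tangent space of `M` being canonically identified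
with the Euclidean model space). -/
abbrev Form (d : ℕ) (M : Type*) (k : ℕ) := M → AltF d k

/-- The wedge product of alternating forms. -/
def wedgeM {V : Type*} [AddCommGroup V] [Module ℝ V] {k l : ℕ}
    (ξ : AlternatingMap ℝ V ℝ (Fin k)) (η : AlternatingMap ℝ V ℝ (Fin l)) :
    AlternatingMap ℝ V ℝ (Fin (k + l)) :=
  (((TensorProduct.lid ℝ ℝ).toLinearMap).compAlternatingMap (ξ.domCoprod η)).domDomCongr
    finSumFinEquiv

/-- Recast an alternating form along an equality of degrees. -/
def castF {V : Type*} [AddCommGroup V] [Module ℝ V] {k l : ℕ} (h : k = l)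
    (ω : AlternatingMap ℝ V ℝ (Fin k)) : AlternatingMap ℝ V ℝ (Fin l) :=
  ω.domDomCongr (finCongr h)

/-- The decomposable alternating form `θ_{u 1} ∧ ⋯ ∧ θ_{u k}` associated with a bilinear
form `b`, where `θ_u = b u ·`; it sends `(w 1, …, w k)` to `det (b (u i) (w j))`. -/
def gramAlt {V : Type*} [AddCommGroup V] [Module ℝ V] {k : ℕ}
    (b : V →ₗ[ℝ] V →ₗ[ℝ] ℝ) (u : Fin k → V) : AlternatingMap ℝ V ℝ (Fin k) :=
  (Matrix.detRowAlternating (R := ℝ) (n := Fin k)).compLinearMap (LinearMap.pi fun i => b (u i))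

/-- The `k`-dimensional volume of the parallelepiped with sides `v 1, …, v k` (the square
root of the Gram determinant), with respect to the Euclidean Riemannian metric. -/
def paraVol {d k : ℕ} (v : Fin k → Eu d) : ℝ :=
  Real.sqrt (Matrix.det (Matrix.of fun i j => (inner ℝ (v i) (v j) : ℝ)))

section ManifoldForms

variable {d : ℕ} {M : Type*} [TopologicalSpace M] [ChartedSpace (Eu d) M]
  [IsManifold (𝓡 d) (⊤ : ℕ∞) M]

/-- The tangent map (differential) of `φ : M → M` at `x`, as a continuous linear map of
the Euclidean model space. -/
def mfd (φ : M → M) (x : M) : Eu d →L[ℝ] Eu d := mfderiv (𝓡 d) (𝓡 d) φ x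

/-- A continuous differential form. -/
def ContForm {k : ℕ} (ω : Form d M k) : Prop :=
  ∀ v : Fin k → Eu d, Continuous fun x => ω x v

/-- A `C¹` differential form. -/
def C1Form {k : ℕ} (ω : Form d M k) : Prop :=
  ∀ v : Fin k → Eu d, ContMDiff (𝓡 d) 𝓘(ℝ, ℝ) 1 fun x => ω x v

/-- A smooth (`C^∞`) differential form. -/
def SmForm {k : ℕ} (ω : Form d M k) : Prop :=
  ∀ v : Fin k → Eu d, ContMDiff (𝓡 d) 𝓘(ℝ, ℝ) (⊤ : ℕ∞) fun x => ω x v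

/-- The pullback of a differential form under a map `φ : M → M`. -/
def pullF (φ : M → M) {k : ℕ} (ω : Form d M k) : Form d M k := fun x =>
  (ω (φ x)).compLinearMap (mfd φ x).toLinearMap

/-- `IsLieDeriv f ω η` says that the Lie derivative of the form `ω` along the flow `f`
exists and equals `η`, i.e. `η = (d/dt)|₀ (f_t)^* ω`. -/
def IsLieDeriv (f : ℝ → M → M) {k : ℕ} (ω η : Form d M k) : Prop :=
  ∀ (x : M) (v : Fin k → Eu d),
    HasDerivAt (fun t : ℝ => pullF (f t) ω x v) (η x v) 0

/-- Membership in `C¹_X Λ^k(M)`: a continuous form whose Lie derivative along the flow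
exists and is continuous. -/
def MemC1X (f : ℝ → M → M) {k : ℕ} (ω : Form d M k) : Prop :=
  ContForm ω ∧ ∃ η : Form d M k, ContForm η ∧ IsLieDeriv f ω η

/-- A continuous Riemannian metric on `M`. -/
def IsRiemMetric (g : M → Eu d →ₗ[ℝ] Eu d →ₗ[ℝ] ℝ) : Prop :=
  (∀ v w : Eu d, Continuous fun x => g x v w) ∧
    (∀ (x : M) (v w : Eu d), g x v w = g x w v) ∧
    ∀ (x : M) (v : Eu d), v ≠ 0 → 0 < g x v v

/-- A smooth Riemannian metric on `M`. -/
def IsSmoothRiemMetric (g : M → Eu d →ₗ[ℝ] Eu d →ₗ[ℝ] ℝ) : Prop :=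
  IsRiemMetric g ∧ ∀ v w : Eu d, ContMDiff (𝓡 d) 𝓘(ℝ, ℝ) (⊤ : ℕ∞) fun x => g x v w

/-- The Riemannian volume form of the metric `g` is `Ω`: every `g`-orthonormal frame has
unit volume. -/
def VolFormEq (g : M → Eu d →ₗ[ℝ] Eu d →ₗ[ℝ] ℝ) (Ω : Form d M d) : Prop :=
  ∀ (x : M) (v : Fin d → Eu d),
    (∀ i j, g x (v i) (v j) = if i = j then 1 else 0) → |Ω x v| = 1

/-- `ip` is the field of inner products induced by the Riemannian metric `g` on exterior
`k`-forms: on decomposable forms it is given by the Gram determinant. This characterizes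
`ip` uniquely. -/
def IsFormInner (g : M → Eu d →ₗ[ℝ] Eu d →ₗ[ℝ] ℝ) {k : ℕ}
    (ip : M → AltF d k →ₗ[ℝ] AltF d k →ₗ[ℝ] ℝ) : Prop :=
  ∀ (x : M) (u v : Fin k → Eu d),
    ip x (gramAlt (g x) u) (gramAlt (g x) v) =
      Matrix.det (Matrix.of fun i j => g x (u i) (v j))

/-- `star` is the (pointwise) Hodge-star operator from `k`-forms to `l`-forms
(`k + l = d`) associated with the volume form `Ω` and the induced inner product `ip` on
`k`-forms, characterized by `ξ ∧ ⋆η = ⟨ξ, η⟩ Ω`. -/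
def IsHodgeStar {k l : ℕ} (h : k + l = d) (Ω : Form d M d)
    (ip : M → AltF d k →ₗ[ℝ] AltF d k →ₗ[ℝ] ℝ)
    (star : M → AltF d k →ₗ[ℝ] AltF d l) : Prop :=
  ∀ (x : M) (ξ η : AltF d k),
    castF h (wedgeM ξ (star x η)) = ip x ξ η • Ω x

/-- The metric `g` is of class `C¹_X`: it is continuous with a continuous Lie derivative
along the flow `f`. -/
def MetricC1X (f : ℝ → M → M) (g : M → Eu d →ₗ[ℝ] Eu d →ₗ[ℝ] ℝ) : Prop :=
  (∀ v w : Eu d, Continuous fun x => g x v w) ∧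
    ∀ v w : Eu d, ∃ gd : M → ℝ, Continuous gd ∧ ∀ x : M,
      HasDerivAt (fun t : ℝ => g (f t x) (mfd (f t) x v) (mfd (f t) x w)) (gd x) 0

end ManifoldForms

/-- A smooth Anosov flow on a closed manifold `M`, with its invariant splitting
`TM = E^{uu} ⊕ E^c ⊕ E^{ss}` and hyperbolicity constants (with respect to the Euclidean
Finsler structure on the tangent spaces). -/
structure AnosovFlow (d : ℕ) (M : Type*) [TopologicalSpace M] [ChartedSpace (Eu d) M]
    [IsManifold (𝓡 d) (⊤ : ℕ∞) M] where
  /-- the flow maps `f_t` -/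
  flow : ℝ → M → M
  flow_zero : ∀ x, flow 0 x = x
  flow_add : ∀ s t x, flow (s + t) x = flow s (flow t x)
  flow_smooth : ContMDiff (𝓘(ℝ, ℝ).prod (𝓡 d)) (𝓡 d) (⊤ : ℕ∞) fun p : ℝ × M => flow p.1 p.2
  /-- the infinitesimal generator `X` -/
  gen : M → Eu d
  gen_spec : ∀ x : M, HasMFDerivAt 𝓘(ℝ, ℝ) (𝓡 d) (fun t => flow t x) 0
      ((1 : ℝ →L[ℝ] ℝ).smulRight (gen x))
  /-- strong unstable bundle -/
  Euu : M → Submodule ℝ (Eu d)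
  /-- center bundle -/
  Ec : M → Submodule ℝ (Eu d)
  /-- strong stable bundle -/
  Ess : M → Submodule ℝ (Eu d)
  Ec_eq : ∀ x, Ec x = Submodule.span ℝ {gen x}
  sup_eq_top : ∀ x, Euu x ⊔ Ec x ⊔ Ess x = ⊤
  indep1 : ∀ x, Euu x ⊓ (Ec x ⊔ Ess x) = ⊥
  indep2 : ∀ x, Ec x ⊓ Ess x = ⊥
  inv_uu : ∀ t x, ∀ v ∈ Euu x, mfd (flow t) x v ∈ Euu (flow t x)
  inv_ss : ∀ t x, ∀ v ∈ Ess x, mfd (flow t) x v ∈ Ess (flow t x)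
  /-- hyperbolicity constant `c` -/
  c : ℝ
  /-- contraction rate `ν` on the strong stable bundle -/
  nu : ℝ
  /-- expansion rate `λ` on the strong unstable bundle -/
  lam : ℝ
  c_pos : 0 < c
  nu_pos : 0 < nu
  lam_pos : 0 < lam
  contr : ∀ t : ℝ, 0 ≤ t → ∀ x, ∀ v ∈ Ess x,
      ‖mfd (flow t) x v‖ ≤ c * Real.exp (-nu * t) * ‖v‖
  expand : ∀ t : ℝ, 0 ≤ t → ∀ x, ∀ w ∈ Euu x,
      c * Real.exp (lam * t) * ‖w‖ ≤ ‖mfd (flow t) x w‖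

namespace AnosovFlow

variable {d : ℕ} {M : Type*} [TopologicalSpace M] [ChartedSpace (Eu d) M]
  [IsManifold (𝓡 d) (⊤ : ℕ∞) M]

/-- An Anosov flow is asymmetric if, in negative time, it shrinks exponentially fast the
volume of every `(n-2)`-dimensional parallelepiped having at least one side in the strong
unstable direction. -/
def Asymmetric (Φ : AnosovFlow d M) : Prop :=
  ∃ C lam' : ℝ, 0 < C ∧ 0 < lam' ∧
    ∀ (x : M) (v : Fin (d - 2) → Eu d), (∃ i, v i ∈ Φ.Euu x) →
      ∀ t : ℝ, 0 ≤ t →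
        paraVol (fun i => mfd (Φ.flow (-t)) x (v i)) ≤
          C * Real.exp (-lam' * t) * paraVol v

/-- The flow preserves the smooth non-vanishing volume form `Ω`. -/
def PreservesVol (Φ : AnosovFlow d M) (Ω : Form d M d) : Prop :=
  SmForm Ω ∧ (∀ x, Ω x ≠ 0) ∧ ∀ t : ℝ, pullF (Φ.flow t) Ω = Ω

/-- `α` is the canonical invariant `1`-form of the flow: the continuous `1`-form with
`ker α = E^{ss} ⊕ E^{uu}` and `α (X) = 1`. -/
def IsCanonOneForm (Φ : AnosovFlow d M) (α : Form d M 1) : Prop :=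
  ContForm α ∧ (∀ (x : M), ∀ v ∈ Φ.Euu x ⊔ Φ.Ess x, α x (fun _ => v) = 0) ∧
    ∀ x : M, α x (fun _ => Φ.gen x) = 1

/-- `g` is an Anosov metric for the flow: `X` is `g`-orthogonal to `E^{ss} ⊕ E^{uu}` and
`g(X, X) = 1`. -/
def IsAnosovMetric (Φ : AnosovFlow d M) (g : M → Eu d →ₗ[ℝ] Eu d →ₗ[ℝ] ℝ) : Prop :=
  IsRiemMetric g ∧ (∀ (x : M), ∀ v ∈ Φ.Euu x ⊔ Φ.Ess x, g x (Φ.gen x) v = 0) ∧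
    ∀ x : M, g x (Φ.gen x) (Φ.gen x) = 1

end AnosovFlow

section Integrability

variable {d : ℕ} {M : Type*} [TopologicalSpace M] [ChartedSpace (Eu d) M]
  [IsManifold (𝓡 d) (⊤ : ℕ∞) M]

/-- A local integral manifold of the distribution `Db`, of dimension `p`, through `x`:
a `C¹` map from the `p`-dimensional model whose differential has range exactly `Db`
everywhere, passing through `x`. -/
def IsIntegralMfld (p : ℕ) (Db : M → Submodule ℝ (Eu d)) (ψ : Eu p → M) (x : M) : Prop :=
  ψ 0 = x ∧ ContMDiff (𝓡 p) (𝓡 d) 1 ψ ∧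
    ∀ y : Eu p,
      (Set.range fun v : Eu p => mfderiv (𝓡 p) (𝓡 d) ψ y v) = (Db (ψ y) : Set (Eu d))

/-- Unique integrability of the distribution `Db` (of rank `p`): through every point
there is an integral manifold, and any two integral manifolds through the same point
locally coincide. -/
def UniquelyIntegrable (p : ℕ) (Db : M → Submodule ℝ (Eu d)) : Prop :=
  ∀ x : M,
    (∃ ψ, IsIntegralMfld p Db ψ x) ∧
      ∀ ψ₁ ψ₂, IsIntegralMfld p Db ψ₁ x → IsIntegralMfld p Db ψ₂ x →
        ∃ ε > 0, ψ₁ '' Metric.ball 0 ε ⊆ Set.range ψ₂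

/-- A distribution (subbundle of `TM`) is `C¹` if, locally, it is spanned by finitely
many `C¹` vector fields. -/
def C1Bundle (Db : M → Submodule ℝ (Eu d)) : Prop :=
  ∀ x₀ : M, ∃ (U : Set M) (p : ℕ) (V : Fin p → M → Eu d), IsOpen U ∧ x₀ ∈ U ∧
    (∀ i, ContMDiffOn (𝓡 d) 𝓘(ℝ, Eu d) 1 (V i) U) ∧
    ∀ x ∈ U, Db x = Submodule.span ℝ (Set.range fun i => V i x)

end Integrability

/-- The exterior derivative data: forms an operator family with the characteristic
properties of the exterior differential. -/
def formCast {d : ℕ} {M : Type*} {k l : ℕ} (h : k = l) (ω : Form d M k) : Form d M l :=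
  fun x => castF h (ω x)

/-- The constant embedding of a function as a differential `0`-form. -/
def zeroForm {d : ℕ} {M : Type*} (φ : M → ℝ) : Form d M 0 := fun x =>
  AlternatingMap.constOfIsEmpty ℝ (Eu d) (Fin 0) (φ x)

/-- An exterior-derivative operator on differential forms: a family of operators on forms
of every degree satisfying the characteristic properties (linearity, action on functions,
the Leibniz rule and `d ∘ d = 0`) which determine the exterior differential uniquely. -/
structure DiffStr (d : ℕ) (M : Type*) [TopologicalSpace M] [ChartedSpace (Eu d) M]
    [IsManifold (𝓡 d) (⊤ : ℕ∞) M] where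
  /-- the exterior derivative -/
  exd : ∀ {k : ℕ}, Form d M k → Form d M (k + 1)
  exd_add : ∀ {k : ℕ} (ω θ : Form d M k), C1Form ω → C1Form θ →
    exd (ω + θ) = exd ω + exd θ
  exd_smul : ∀ {k : ℕ} (a : ℝ) (ω : Form d M k), C1Form ω → exd (a • ω) = a • exd ω
  exd_fun : ∀ φ : M → ℝ, ContMDiff (𝓡 d) 𝓘(ℝ, ℝ) 1 φ → ∀ (x : M) (v : Fin 1 → Eu d),
    exd (zeroForm φ) x v = (mfderiv (𝓡 d) 𝓘(ℝ, ℝ) φ x : Eu d →L[ℝ] ℝ) (v 0)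
  exd_cont : ∀ {k : ℕ} (ω : Form d M k), C1Form ω → ContForm (exd ω)
  exd_smooth : ∀ {k : ℕ} (ω : Form d M k), SmForm ω → SmForm (exd ω)
  exd_wedge : ∀ {k l : ℕ} (ω : Form d M k) (θ : Form d M l), C1Form ω → C1Form θ →
    exd (fun x => wedgeM (ω x) (θ x)) =
      formCast (by omega) (fun x => wedgeM (exd ω x) (θ x)) +
        ((-1 : ℝ) ^ k) • formCast (by omega) (fun x => wedgeM (ω x) (exd θ x))
  exd_exd : ∀ {k : ℕ} (ω : Form d M k), SmForm ω → exd (exd ω) = 0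

/-- Integration of `n`-forms over a closed (oriented) manifold `M` with distinguished
volume form `Ω` satisfying `∫_M Ω = 1`: a linear positive normalized functional vanishing
on exact forms; these properties determine the integral uniquely. -/
structure IntStr (d : ℕ) (M : Type*) [TopologicalSpace M] [ChartedSpace (Eu d) M]
    [IsManifold (𝓡 d) (⊤ : ℕ∞) M] (Ω : Form d M d) (D : DiffStr d M) where
  /-- the integral `∫_M` of an `n`-form -/
  intg : Form d M d → ℝ
  intg_add : ∀ ω θ : Form d M d, ContForm ω → ContForm θ → intg (ω + θ) = intg ω + intg θ
  intg_smul : ∀ (a : ℝ) (ω : Form d M d), ContForm ω → intg (a • ω) = a * intg ω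
  intg_nonneg : ∀ h : M → ℝ, Continuous h → (∀ x, 0 ≤ h x) →
    0 ≤ intg fun x => h x • Ω x
  intg_vol : intg Ω = 1
  intg_exact : ∀ {k : ℕ} (hk : k + 1 = d) (ω : Form d M k), C1Form ω →
    intg (formCast hk (D.exd ω)) = 0

section L2

variable {d : ℕ} {M : Type*} [TopologicalSpace M] [ChartedSpace (Eu d) M]
  [IsManifold (𝓡 d) (⊤ : ℕ∞) M]

/-- `J` realizes the Hilbert space `H` as the `L²`-completion of the space of continuous
`k`-forms, with respect to the `L²` inner product `⟨ξ, η⟩ = ∫_M ⟨ξ_x, η_x⟩_g Ω`. -/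
structure IsL2Rep {Ω : Form d M d} {D : DiffStr d M} (I : IntStr d M Ω D) {k : ℕ}
    (ip : M → AltF d k →ₗ[ℝ] AltF d k →ₗ[ℝ] ℝ) {H : Type*} [NormedAddCommGroup H]
    [InnerProductSpace ℝ H] (J : Form d M k → H) : Prop where
  jadd : ∀ ξ η : Form d M k, ContForm ξ → ContForm η → J (ξ + η) = J ξ + J η
  jsmul : ∀ (a : ℝ) (ξ : Form d M k), ContForm ξ → J (a • ξ) = a • J ξ
  jip : ∀ ξ η : Form d M k, ContForm ξ → ContForm η →
    ⟪J ξ, J η⟫ = I.intg fun x => ip x (ξ x) (η x) • Ω x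
  jdense : Dense (J '' {ω : Form d M k | ContForm ω})

/-- The "adjoint graph" of a set `G ⊆ H × H`: all pairs `(η, ζ)` such that
`⟨w, η⟩ = ⟨v, ζ⟩` for every `(v, w) ∈ G`. Applied to the graph of a densely defined
operator it yields the graph of its Hilbert-space adjoint. -/
def adjGraph {H : Type*} [NormedAddCommGroup H] [InnerProductSpace ℝ H]
    (G : Set (H × H)) : Set (H × H) :=
  {q | ∀ p ∈ G, ⟪p.2, q.1⟫ = ⟪p.1, q.2⟫}

end L2


section LinAlg

variable {d : ℕ}

/-- Volume of a parallelepiped with sides indexed by an arbitrary finite type. -/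
def pv {ι : Type*} [Fintype ι] [DecidableEq ι] (v : ι → Eu d) : ℝ :=
  Real.sqrt (Matrix.det (Matrix.gram ℝ v))

theorem paraVol_eq_pv {k : ℕ} (v : Fin k → Eu d) : paraVol v = pv v := rfl

theorem pv_nonneg {ι : Type*} [Fintype ι] [DecidableEq ι] (v : ι → Eu d) : 0 ≤ pv v :=
  Real.sqrt_nonneg _

theorem pv_of_dep {ι : Type*} [Fintype ι] [DecidableEq ι] (v : ι → Eu d)
    (h : ¬ LinearIndependent ℝ v) : pv v = 0 := by
  have : Matrix.det (Matrix.gram ℝ v) = 0 := by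
    by_contra h'
    exact h (Matrix.linearIndependent_of_det_gram_ne_zero h')
  simp [pv, this]

theorem pv_pos {ι : Type*} [Fintype ι] [DecidableEq ι] (v : ι → Eu d)
    (h : LinearIndependent ℝ v) : 0 < pv v :=
  Real.sqrt_pos.2 (Matrix.posDef_gram_of_linearIndependent h).det_pos

theorem pv_comp {ι κ : Type*} [Fintype ι] [DecidableEq ι] [Fintype κ] [DecidableEq κ]
    (e : κ ≃ ι) (v : ι → Eu d) : pv (fun i => v (e i)) = pv v := by
  have : Matrix.gram ℝ (fun i => v (e i)) = (Matrix.gram ℝ v).submatrix e e := by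
    ext i j; simp [Matrix.gram_apply]
  simp [pv, this]

theorem pv_orthonormal {ι : Type*} [Fintype ι] [DecidableEq ι] (v : ι → Eu d)
    (h : Orthonormal ℝ v) : pv v = 1 := by
  simp [pv, Matrix.gram_eq_one_iff_orthonormal.2 h]

theorem pv_orth_one {ι : Type*} [Fintype ι] [DecidableEq ι] (w : ι → Eu d) (z : Eu d)
    (h : ∀ i, inner ℝ (w i) z = 0) :
    pv (Sum.elim w (fun _ : Fin 1 => z)) = pv w * ‖z‖ := by
  have : Matrix.gram ℝ (Sum.elim w (fun _ : Fin 1 => z)) =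
      Matrix.fromBlocks (Matrix.gram ℝ w) 0 0 (Matrix.gram ℝ (fun _ : Fin 1 => z)) := by
    ext i j
    rcases i with i | i <;> rcases j with j | j <;>
      simp [Matrix.gram_apply, h]
    rw [real_inner_comm]; exact h _
  rw [pv, this, Matrix.det_fromBlocks_zero₂₁,
    Real.sqrt_mul (Matrix.posSemidef_gram ℝ w).det_nonneg, pv]
  congr 1
  simp [Matrix.gram_apply]

/-- Central lemma: alternating forms on a subspace of the right dimension. -/
theorem exists_onb_span {ι : Type*} [Fintype ι] [DecidableEq ι] (S : Submodule ℝ (Eu d))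
    (hS : Module.finrank ℝ S = Fintype.card ι) :
    ∃ (b : ι → Eu d) (D : (ι → Eu d) → ℝ), Orthonormal ℝ b ∧ (∀ i, b i ∈ S) ∧
      ∀ y : ι → Eu d, (∀ i, y i ∈ S) → |D y| = pv y ∧
        ∀ f : AlternatingMap ℝ (Eu d) ℝ ι, f y = D y * f b := by
  classical
  let b0 : OrthonormalBasis ι ℝ S :=
    (stdOrthonormalBasis ℝ S).reindex ((finCongr hS).trans (Fintype.equivFin ι).symm)
  refine ⟨fun i => (b0 i : Eu d), fun y => if h : ∀ i, y i ∈ S then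
    b0.toBasis.det (fun i => (⟨y i, h i⟩ : S)) else 0, ?_, fun i => (b0 i).2, ?_⟩
  · exact b0.orthonormal.comp_linearIsometry S.subtypeₗᵢ
  · intro y hy
    simp only [hy, implies_true, dite_true]
    constructor
    · have h1 : Matrix.gram ℝ y = Matrix.gram ℝ (fun i => (⟨y i, hy i⟩ : S)) := by
        ext i j; simp [Matrix.gram_apply]
      rw [pv, h1, Matrix.gram_eq_conjTranspose_mul b0, Matrix.det_mul, Module.Basis.det_apply,
        Matrix.det_conjTranspose]
      simp only [star_trivial]
      rw [Real.sqrt_mul_self_eq_abs]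
      congr 2
    · intro f
      have := congrArg (fun g => g (fun i => (⟨y i, hy i⟩ : S)))
        ((f.compLinearMap S.subtype).eq_smul_basis_det b0.toBasis)
      simp only [AlternatingMap.smul_apply, AlternatingMap.compLinearMap_apply, smul_eq_mul] at this
      rw [mul_comm]
      simpa [Function.comp_def] using this

/-- Version for a linearly independent family. -/
theorem exists_onb {ι : Type*} [Fintype ι] [DecidableEq ι] (w : ι → Eu d)
    (hw : LinearIndependent ℝ w) :
    ∃ (b : ι → Eu d) (r : ℝ), Orthonormal ℝ b ∧ (∀ i, b i ∈ Submodule.span ℝ (Set.range w)) ∧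
      |r| = pv w ∧ ∀ f : AlternatingMap ℝ (Eu d) ℝ ι, f w = r * f b := by
  obtain ⟨b, D, hb, hbS, h⟩ := exists_onb_span (Submodule.span ℝ (Set.range w))
    (finrank_span_eq_card hw)
  obtain ⟨h1, h2⟩ := h w fun i => Submodule.subset_span ⟨i, rfl⟩
  exact ⟨b, D w, hb, hbS, h1, h2⟩

/-- Fixing the last block of arguments of an alternating map. -/
def fixR {ι κ : Type*} [DecidableEq ι] [DecidableEq κ]
    (f : AlternatingMap ℝ (Eu d) ℝ (ι ⊕ κ)) (z : κ → Eu d) :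
    AlternatingMap ℝ (Eu d) ℝ ι where
  toFun v := f (Sum.elim v z)
  map_update_add' v i x y := by
    have : ∀ (inst : DecidableEq ι) a, Sum.elim (@Function.update _ _ inst v i a) z =
      Function.update (Sum.elim v z) (Sum.inl i) a := by
      intro inst a
      ext j : 1
      rcases j with j | j
      · by_cases hj : j = i
        · subst hj; simp
        · simp [Function.update_of_ne, hj]
      · simp
    simp only [this]
    exact f.map_update_add _ _ _ _
  map_update_smul' v i c x := by
    have : ∀ (inst : DecidableEq ι) a, Sum.elim (@Function.update _ _ inst v i a) z =
      Function.update (Sum.elim v z) (Sum.inl i) a := by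
      intro inst a
      ext j : 1
      rcases j with j | j
      · by_cases hj : j = i
        · subst hj; simp
        · simp [Function.update_of_ne, hj]
      · simp
    simp only [this]
    exact f.map_update_smul _ _ _ _
  map_eq_zero_of_eq' v i j h hij :=
    f.map_eq_zero_of_eq (i := Sum.inl i) (j := Sum.inl j) _ (by simpa using h) (by simpa using hij)

/-- Fixing the first block of arguments of an alternating map. -/
def fixL {ι κ : Type*} [DecidableEq ι] [DecidableEq κ]
    (f : AlternatingMap ℝ (Eu d) ℝ (ι ⊕ κ)) (v : ι → Eu d) :
    AlternatingMap ℝ (Eu d) ℝ κ :=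
  fixR (f.domDomCongr (Equiv.sumComm ι κ)) v

theorem fixR_apply {ι κ : Type*} [DecidableEq ι] [DecidableEq κ]
    (f : AlternatingMap ℝ (Eu d) ℝ (ι ⊕ κ)) (v : ι → Eu d) (z : κ → Eu d) :
    fixR f z v = f (Sum.elim v z) := rfl

theorem fixL_apply {ι κ : Type*} [DecidableEq ι] [DecidableEq κ]
    (f : AlternatingMap ℝ (Eu d) ℝ (ι ⊕ κ)) (v : ι → Eu d) (z : κ → Eu d) :
    fixL f v z = f (Sum.elim v z) := by
  change f (fun i => Sum.elim z v (Equiv.sumComm ι κ i)) = _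
  congr 1
  ext i : 1
  rcases i with i | i <;> simp

theorem alt_congr {ι : Type*} [Fintype ι] [DecidableEq ι] (f : AlternatingMap ℝ (Eu d) ℝ ι)
    (E : Submodule ℝ (Eu d)) (hf : ∀ v : ι → Eu d, (∃ i, v i ∈ E) → f v = 0)
    (v v' : ι → Eu d) (h : ∀ i, v i - v' i ∈ E) : f v = f v' := by
  have key : ∀ s : Finset ι, f (s.piecewise v v') = f v' := by
    intro s
    induction s using Finset.induction_on with
    | empty => simp
    | insert i s hi ih =>
      rw [← ih, Finset.piecewise_insert]
      have h2 : f (Function.update (s.piecewise v v') i (v i - v' i)) = 0 :=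
        hf _ ⟨i, by simpa using h i⟩
      rw [AlternatingMap.map_update_sub, sub_eq_zero] at h2
      rw [h2]
      congr 1
      ext j : 1
      by_cases hj : j = i
      · subst hj; simp [hi]
      · simp [hj]
  simpa using key Finset.univ

theorem alt_zero_span {ι κ : Type*} [Fintype ι] [DecidableEq ι] [DecidableEq κ]
    (f : AlternatingMap ℝ (Eu d) ℝ (κ ⊕ ι)) (w : κ → Eu d) (v : ι → Eu d)
    (h : ∃ i, v i ∈ Submodule.span ℝ (Set.range w)) : f (Sum.elim w v) = 0 := by
  obtain ⟨i, hi⟩ := h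
  rw [← fixL_apply]
  have : ∀ a ∈ Submodule.span ℝ (Set.range w), fixL f w (Function.update v i a) = 0 := by
    intro a ha
    induction ha using Submodule.span_induction with
    | mem x hx =>
      obtain ⟨j, rfl⟩ := hx
      rw [fixL_apply]
      exact f.map_eq_zero_of_eq (i := Sum.inl j) (j := Sum.inr i) _ (by simp) (by simp)
    | zero => simp
    | add x y _ _ hx hy => simp [hx, hy]
    | smul a x _ hx => simp [hx]
  simpa using this _ hi

theorem alt_congr_span {ι κ : Type*} [Fintype ι] [DecidableEq ι] [DecidableEq κ]
    (f : AlternatingMap ℝ (Eu d) ℝ (κ ⊕ ι)) (w : κ → Eu d) (v v' : ι → Eu d)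
    (h : ∀ i, v i - v' i ∈ Submodule.span ℝ (Set.range w)) :
    f (Sum.elim w v) = f (Sum.elim w v') := by
  rw [← fixL_apply, ← fixL_apply]
  refine alt_congr _ (Submodule.span ℝ (Set.range w)) ?_ v v' h
  intro v hv
  rw [fixL_apply]
  exact alt_zero_span f w v hv

theorem orthonormal_sum {ι κ : Type*} (b : ι → Eu d) (n : κ → Eu d) (hb : Orthonormal ℝ b)
    (hn : Orthonormal ℝ n) (h : ∀ i j, inner ℝ (b i) (n j) = 0) :
    Orthonormal ℝ (Sum.elim b n) := by
  classical
  rw [orthonormal_iff_ite] at *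
  intro i j
  rcases i with i | i <;> rcases j with j | j <;> simp [hb, hn, h]
  rw [real_inner_comm]; exact h _ _

theorem inner_span_zero {ι : Type*} (w : ι → Eu d) (z : Eu d) (h : ∀ i, inner ℝ (w i) z = 0)
    (a : Eu d) (ha : a ∈ Submodule.span ℝ (Set.range w)) : inner ℝ a z = 0 := by
  induction ha using Submodule.span_induction with
  | mem x hx => obtain ⟨j, rfl⟩ := hx; exact h j
  | zero => simp
  | add x y _ _ hx hy => simp [inner_add_left, hx, hy]
  | smul a x _ hx => simp [inner_smul_left, hx]

/-- Comparison of a form with the volume form. -/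
theorem vol_lower {ι κ : Type*} [Fintype ι] [DecidableEq ι] [Fintype κ] [DecidableEq κ]
    (f : AlternatingMap ℝ (Eu d) ℝ (ι ⊕ κ)) (m0 : ℝ)
    (hf : ∀ b : ι ⊕ κ → Eu d, Orthonormal ℝ b → m0 ≤ |f b|)
    (w : ι → Eu d) (n : κ → Eu d) (hn : Orthonormal ℝ n)
    (h : ∀ i j, inner ℝ (w i) (n j) = 0) :
    m0 * pv w ≤ |f (Sum.elim w n)| := by
  by_cases hw : LinearIndependent ℝ w
  · obtain ⟨b, r, hb, hbS, hr, hall⟩ := exists_onb w hw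
    have := hall (fixR f n)
    rw [fixR_apply, fixR_apply] at this
    rw [this, abs_mul, hr, mul_comm]
    refine mul_le_mul_of_nonneg_left (hf _ ?_) (pv_nonneg _)
    exact orthonormal_sum b n hb hn fun i j => inner_span_zero w _ (fun i => h i j) _ (hbS i)
  · rw [pv_of_dep w hw]; simp

theorem vol_upper {ι : Type*} [Fintype ι] [DecidableEq ι]
    (f : AlternatingMap ℝ (Eu d) ℝ ι) (K : ℝ)
    (hf : ∀ b : ι → Eu d, Orthonormal ℝ b → |f b| ≤ K)
    (w : ι → Eu d) : |f w| ≤ K * pv w := by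
  by_cases hw : LinearIndependent ℝ w
  · obtain ⟨b, r, hb, hbS, hr, hall⟩ := exists_onb w hw
    rw [hall f, abs_mul, hr, mul_comm]
    exact mul_le_mul_of_nonneg_right (hf _ hb) (pv_nonneg _)
  · rw [pv_of_dep w hw, f.map_linearDependent w hw]; simp

/-- The Gram matrix form. -/
theorem exists_dual_form {ι : Type*} [Fintype ι] [DecidableEq ι] (b : ι → Eu d)
    (hb : Orthonormal ℝ b) : ∃ f : AlternatingMap ℝ (Eu d) ℝ ι, f b = 1 := by
  refine ⟨(Matrix.detRowAlternating (R := ℝ) (n := ι)).compLinearMap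
    (LinearMap.pi fun i => innerₗ (Eu d) (b i)), ?_⟩
  have : (fun i => (LinearMap.pi fun i => innerₗ (Eu d) (b i)) (b i)) = (1 : Matrix ι ι ℝ) := by
    ext i j
    rw [orthonormal_iff_ite] at hb
    simp [hb, Matrix.one_apply, eq_comm]
  rw [AlternatingMap.compLinearMap_apply]
  have h2 := Matrix.det_one (n := ι) (R := ℝ)
  rw [← this] at h2
  exact h2

theorem pv_add_span {ι : Type*} [Fintype ι] [DecidableEq ι] (w : ι → Eu d) (a z : Eu d)
    (hli : LinearIndependent ℝ (Sum.elim w (fun _ : Fin 1 => a)))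
    (h : a - z ∈ Submodule.span ℝ (Set.range w)) :
    pv (Sum.elim w (fun _ : Fin 1 => a)) = pv (Sum.elim w (fun _ : Fin 1 => z)) := by
  obtain ⟨b, D, hb, hbS, hall⟩ := exists_onb_span
    (Submodule.span ℝ (Set.range (Sum.elim w (fun _ : Fin 1 => a)))) (finrank_span_eq_card hli)
  obtain ⟨f, hf⟩ := exists_dual_form b hb
  have hw : ∀ i, w i ∈ Submodule.span ℝ (Set.range (Sum.elim w (fun _ : Fin 1 => a))) :=
    fun i => Submodule.subset_span ⟨Sum.inl i, rfl⟩
  have ha : a ∈ Submodule.span ℝ (Set.range (Sum.elim w (fun _ : Fin 1 => a))) :=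
    Submodule.subset_span ⟨Sum.inr 0, rfl⟩
  have haz := (Submodule.span_le (p := Submodule.span ℝ
    (Set.range (Sum.elim w (fun _ : Fin 1 => a))))).2 (by rintro _ ⟨i, rfl⟩; exact hw i) h
  have hz : z ∈ Submodule.span ℝ (Set.range (Sum.elim w (fun _ : Fin 1 => a))) := by
    have := Submodule.sub_mem _ ha haz
    simpa using this
  obtain ⟨h1, h2⟩ := hall (Sum.elim w (fun _ : Fin 1 => a))
    (by rintro (i | i); exacts [hw i, ha])
  obtain ⟨h3, h4⟩ := hall (Sum.elim w (fun _ : Fin 1 => z))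
    (by rintro (i | i); exacts [hw i, hz])
  have h5 := alt_congr_span f w (fun _ : Fin 1 => a) (fun _ => z) (fun _ => h)
  rw [h2 f, h4 f, hf, mul_one, mul_one] at h5
  rw [← h1, ← h3, h5]

/-- Orthonormal complement of a small independent family. -/
theorem exists_compl {ι : Type*} [Fintype ι] (w : ι → Eu d)
    (hw : LinearIndependent ℝ w) (m : ℕ) (hm : Fintype.card ι + m = d) :
    ∃ n : Fin m → Eu d, Orthonormal ℝ n ∧ ∀ i j, inner ℝ (w i) (n j) = 0 := by
  have h1 : Module.finrank ℝ (Submodule.span ℝ (Set.range w))ᗮ = m := by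
    have := (Submodule.span ℝ (Set.range w)).finrank_add_finrank_orthogonal
    rw [finrank_span_eq_card hw] at this
    simp at this
    omega
  let b := (stdOrthonormalBasis ℝ (Submodule.span ℝ (Set.range w))ᗮ).reindex (finCongr h1)
  refine ⟨fun i => (b i : Eu d),
    b.orthonormal.comp_linearIsometry (Submodule.subtypeₗᵢ _), fun i j => ?_⟩
  exact Submodule.inner_right_of_mem_orthogonal (Submodule.subset_span (Set.mem_range_self i)) (b j).2

/-- Orthonormal complement with a prescribed first vector. -/
theorem exists_compl_with {ι : Type*} [Fintype ι] (w : ι → Eu d)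
    (hw : LinearIndependent ℝ w) (m : ℕ) (hm : Fintype.card ι + m = d) (hm0 : 0 < m)
    (u : Eu d) (hu : ‖u‖ = 1) (huw : ∀ i, inner ℝ (w i) u = 0) :
    ∃ n : Fin m → Eu d, Orthonormal ℝ n ∧ (∀ i j, inner ℝ (w i) (n j) = 0) ∧
      ∃ j, n j = u := by
  set S := (Submodule.span ℝ (Set.range w))ᗮ with hSdef
  have h1 : Module.finrank ℝ S = m := by
    have := (Submodule.span ℝ (Set.range w)).finrank_add_finrank_orthogonal
    rw [finrank_span_eq_card hw, ← hSdef] at this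
    simp at this
    omega
  have huS : u ∈ S := by
    rw [hSdef, Submodule.mem_orthogonal]
    intro a ha
    exact inner_span_zero w u huw a ha
  let u' : S := ⟨u, huS⟩
  obtain ⟨b, hb⟩ := Orthonormal.exists_orthonormalBasis_extension_of_card_eq (𝕜 := ℝ) (E := S)
    (ι := Fin m) (by simp [h1]) (v := fun _ => u') (s := {⟨0, hm0⟩}) (by
      rw [orthonormal_iff_ite]
      rintro ⟨i, hi⟩ ⟨j, hj⟩
      simp only [Set.mem_singleton_iff] at hi hj
      subst hi; subst hj
      simp only [Set.domRestrict_apply, if_true]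
      rw [real_inner_self_eq_norm_sq]
      have : ‖u'‖ = 1 := hu
      simp [this])
  refine ⟨fun i => (b i : Eu d),
    b.orthonormal.comp_linearIsometry (Submodule.subtypeₗᵢ _), fun i j => ?_, ⟨0, hm0⟩, ?_⟩
  · exact Submodule.inner_right_of_mem_orthogonal (Submodule.subset_span (Set.mem_range_self i)) (b j).2
  · change (b ⟨0, hm0⟩ : Eu d) = u
    rw [hb _ rfl]

/-- An orthonormal frame has the same volume as the standard frame. -/
theorem abs_top_onb (f : AltF d d) (b : Fin d → Eu d) (hb : Orthonormal ℝ b) :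
    |f b| = |f (EuclideanSpace.basisFun (Fin d) ℝ)| := by
  obtain ⟨b', D, hb', -, h⟩ := exists_onb_span (ι := Fin d) (⊤ : Submodule ℝ (Eu d)) (by simp)
  obtain ⟨h1, h2⟩ := h b (by simp)
  obtain ⟨h3, h4⟩ := h (EuclideanSpace.basisFun (Fin d) ℝ) (by simp)
  rw [h2 f, h4 f, abs_mul, abs_mul, h1, h3, pv_orthonormal _ hb,
    pv_orthonormal _ (EuclideanSpace.basisFun (Fin d) ℝ).orthonormal]

theorem alt_bound {k : ℕ} (f : AltF d k) (v : Fin k → Eu d) :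
    |f v| ≤ (∑ r : Fin k → Fin d, |f fun i => EuclideanSpace.basisFun (Fin d) ℝ (r i)|) *
      ∏ i, ‖v i‖ := by
  have hv : v = fun i => ∑ j, (v i j) • EuclideanSpace.basisFun (Fin d) ℝ j := by
    ext i : 1
    exact ((EuclideanSpace.basisFun (Fin d) ℝ).sum_repr (v i)).symm
  have h1 : f v = ∑ r : Fin k → Fin d, (∏ i, v i (r i)) *
      f fun i => EuclideanSpace.basisFun (Fin d) ℝ (r i) := by
    conv_lhs => rw [hv]
    have := f.toMultilinearMap.map_sum
      (fun (i : Fin k) (j : Fin d) => (v i j) • EuclideanSpace.basisFun (Fin d) ℝ j)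
    refine this.trans (Finset.sum_congr rfl fun r _ => ?_)
    exact f.toMultilinearMap.map_smul_univ _ _
  rw [h1, Finset.sum_mul]
  refine (Finset.abs_sum_le_sum_abs _ _).trans (Finset.sum_le_sum fun r _ => ?_)
  rw [abs_mul, mul_comm, Finset.abs_prod]
  refine mul_le_mul_of_nonneg_left ?_ (abs_nonneg _)
  exact Finset.prod_le_prod (fun _ _ => abs_nonneg _) fun i _ => by
    simpa using PiLp.norm_apply_le (v i) (r i)

end LinAlg

section Dyn

set_option linter.unusedSectionVars false

variable {d : ℕ} {M : Type*} [TopologicalSpace M] [ChartedSpace (Eu d) M]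
  [IsManifold (𝓡 d) (⊤ : ℕ∞) M]

theorem flow_mdiff (Φ : AnosovFlow d M) (t : ℝ) (x : M) :
    MDifferentiableAt (𝓡 d) (𝓡 d) (Φ.flow t) x := by
  have h : ContMDiff (𝓡 d) (𝓘(ℝ, ℝ).prod (𝓡 d)) (⊤ : ℕ∞) (fun y : M => (t, y)) :=
    contMDiff_const.prodMk contMDiff_id
  have h2 := Φ.flow_smooth.comp h
  exact (h2.mdifferentiable (by simp)) x

theorem mfd_add (Φ : AnosovFlow d M) (s t : ℝ) (x : M) (v : Eu d) :
    mfd (Φ.flow (s + t)) x v = mfd (Φ.flow s) (Φ.flow t x) (mfd (Φ.flow t) x v) := by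
  have h : Φ.flow (s + t) = Φ.flow s ∘ Φ.flow t := funext fun y => Φ.flow_add s t y
  unfold mfd
  rw [h, mfderiv_comp x (flow_mdiff Φ s _) (flow_mdiff Φ t x)]
  rfl

theorem mfd_zero (Φ : AnosovFlow d M) (x : M) (v : Eu d) : mfd (Φ.flow 0) x v = v := by
  have h : Φ.flow 0 = id := funext fun y => Φ.flow_zero y
  unfold mfd
  rw [h, mfderiv_id]
  rfl

theorem flow_neg (Φ : AnosovFlow d M) (t : ℝ) (x : M) : Φ.flow t (Φ.flow (-t) x) = x := by
  rw [← Φ.flow_add, add_neg_cancel, Φ.flow_zero]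

theorem mfd_neg (Φ : AnosovFlow d M) (t : ℝ) (x : M) (v : Eu d) :
    mfd (Φ.flow t) (Φ.flow (-t) x) (mfd (Φ.flow (-t)) x v) = v := by
  rw [← mfd_add, add_neg_cancel, mfd_zero]

theorem flow_neg' (Φ : AnosovFlow d M) (t : ℝ) (x : M) : Φ.flow (-t) (Φ.flow t x) = x := by
  rw [← Φ.flow_add, neg_add_cancel, Φ.flow_zero]

theorem mfd_neg' (Φ : AnosovFlow d M) (t : ℝ) (x : M) (v : Eu d) :
    mfd (Φ.flow (-t)) (Φ.flow t x) (mfd (Φ.flow t) x v) = v := by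
  rw [← mfd_add, neg_add_cancel, mfd_zero]

theorem mfd_inj (Φ : AnosovFlow d M) (t : ℝ) (x : M) :
    Function.Injective (mfd (d := d) (Φ.flow t) x) := by
  intro a b h
  rw [← mfd_neg' Φ t x a, ← mfd_neg' Φ t x b, h]

/-- Invariance of a field of alternating forms. -/
def InvF (Φ : AnosovFlow d M) {ι : Type*} (η : M → AlternatingMap ℝ (Eu d) ℝ ι) : Prop :=
  ∀ t x (v : ι → Eu d), η (Φ.flow t x) (fun i => mfd (Φ.flow t) x (v i)) = η x v

/-- Uniform boundedness of a field of alternating forms. -/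
def BddF {ι : Type*} [Fintype ι] (η : M → AlternatingMap ℝ (Eu d) ℝ ι) (K : ℝ) : Prop :=
  0 < K ∧ ∀ x (v : ι → Eu d), |η x v| ≤ K * ∏ i, ‖v i‖

/-- Uniform lower bound on orthonormal frames. -/
def LowF {ι : Type*} (η : M → AlternatingMap ℝ (Eu d) ℝ ι) (m : ℝ) : Prop :=
  0 < m ∧ ∀ x (v : ι → Eu d), Orthonormal ℝ v → m ≤ |η x v|

theorem BddF.onb {ι : Type*} [Fintype ι] {η : M → AlternatingMap ℝ (Eu d) ℝ ι} {K : ℝ}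
    (h : BddF η K) (x : M) (b : ι → Eu d) (hb : Orthonormal ℝ b) : |η x b| ≤ K := by
  simpa [hb.1] using h.2 x b

theorem invF_of_lie (Φ : AnosovFlow d M) {k : ℕ} (ω : Form d M k)
    (hinv : IsLieDeriv Φ.flow ω 0) : InvF Φ ω := by
  intro t x v
  have hd : ∀ s : ℝ, HasDerivAt (fun t : ℝ => pullF (Φ.flow t) ω x v) 0 s := by
    intro s
    have h1 := hinv (Φ.flow s x) (fun i => mfd (Φ.flow s) x (v i))
    have h1' : HasDerivAt (fun t : ℝ => pullF (Φ.flow t) ω (Φ.flow s x)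
        (fun i => mfd (Φ.flow s) x (v i))) 0 (s - s) := by
      rw [sub_self]; exact h1
    have h2 := h1'.comp_sub_const s s
    refine h2.congr_of_eventuallyEq (Eventually.of_forall fun r => ?_)
    change ω (Φ.flow r x) (fun i => mfd (Φ.flow r) x (v i)) =
      ω (Φ.flow (r - s) (Φ.flow s x))
        (fun i => mfd (Φ.flow (r - s)) (Φ.flow s x) (mfd (Φ.flow s) x (v i)))
    simp only [← mfd_add, ← Φ.flow_add, sub_add_cancel]
  have h3 := is_const_of_deriv_eq_zero (fun s => (hd s).differentiableAt)
    (fun s => (hd s).deriv) t 0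
  change ω (Φ.flow t x) (fun i => mfd (Φ.flow t) x (v i)) =
    ω (Φ.flow 0 x) (fun i => mfd (Φ.flow 0) x (v i)) at h3
  simpa only [mfd_zero, Φ.flow_zero] using h3

theorem bddF_of_cont [CompactSpace M] {k : ℕ} (ω : Form d M k) (hω : ContForm ω) :
    ∃ K, BddF ω K := by
  have hc : Continuous fun x => ∑ r : Fin k → Fin d,
      |ω x fun i => EuclideanSpace.basisFun (Fin d) ℝ (r i)| :=
    continuous_finsetSum _ fun r _ => (hω _).abs
  obtain ⟨K, hK⟩ := (isCompact_range hc).bddAbove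
  refine ⟨max K 1, by positivity, fun x v => (alt_bound (ω x) v).trans ?_⟩
  refine mul_le_mul_of_nonneg_right ?_ (Finset.prod_nonneg fun _ _ => norm_nonneg _)
  exact (hK ⟨x, rfl⟩).trans (le_max_left _ _)

theorem lowF_of_cont [CompactSpace M] [Nonempty M] (Ω : Form d M d) (hΩ : ContForm Ω)
    (h0 : ∀ x, Ω x ≠ 0) : ∃ m, LowF Ω m := by
  have hc := (hΩ (EuclideanSpace.basisFun (Fin d) ℝ)).abs
  obtain ⟨x0, -, hx0⟩ := isCompact_univ.exists_isMinOn Set.univ_nonempty hc.continuousOn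
  refine ⟨|Ω x0 (EuclideanSpace.basisFun (Fin d) ℝ)|, abs_pos.2 ?_, fun x v hv => ?_⟩
  · have := (AlternatingMap.map_basis_ne_zero_iff
      (EuclideanSpace.basisFun (Fin d) ℝ).toBasis (Ω x0)).2 (h0 x0)
    simpa using this
  · rw [abs_top_onb (Ω x) v hv]
    exact hx0 (Set.mem_univ x)

/-- Contraction property of `k`-dimensional volumes in negative time. -/
def PP (Φ : AnosovFlow d M) (ι : Type*) [Fintype ι] [DecidableEq ι] : Prop :=
  ∀ δ : ℝ, 0 < δ → ∃ t : ℝ, 0 ≤ t ∧ ∀ (x : M) (v : ι → Eu d), (∃ i, v i ∈ Φ.Euu x) →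
    pv (fun i => mfd (Φ.flow (-t)) x (v i)) ≤ δ * pv v

theorem PP.congr {Φ : AnosovFlow d M} {ι κ : Type*} [Fintype ι] [DecidableEq ι] [Fintype κ]
    [DecidableEq κ] (h : PP Φ ι) (e : ι ≃ κ) : PP Φ κ := by
  intro δ hδ
  obtain ⟨t, ht, hh⟩ := h δ hδ
  refine ⟨t, ht, fun x v ⟨i, hi⟩ => ?_⟩
  have := hh x (fun i => v (e i)) ⟨e.symm i, by simpa using hi⟩
  rwa [pv_comp e v, pv_comp e (fun i => mfd (Φ.flow (-t)) x (v i))] at this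

theorem exists_exp_small (C lam δ : ℝ) (hl : 0 < lam) (hδ : 0 < δ) :
    ∃ t : ℝ, 0 ≤ t ∧ C * Real.exp (-lam * t) ≤ δ := by
  have h1 : Tendsto (fun t : ℝ => C * Real.exp (-lam * t)) atTop (𝓝 (C * 0)) := by
    refine Tendsto.const_mul C (Real.tendsto_exp_atBot.comp ?_)
    exact tendsto_id.const_mul_atTop_of_neg (by linarith)
  rw [mul_zero] at h1
  obtain ⟨t, h2, h3⟩ := ((h1.eventually_lt_const hδ).and (eventually_ge_atTop 0)).exists
  exact ⟨t, h3, h2.le⟩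

theorem PP_base (Φ : AnosovFlow d M) (h : Φ.Asymmetric) : PP Φ (Fin (d - 2)) := by
  obtain ⟨C, lam, _, hl, hh⟩ := h
  intro δ hδ
  obtain ⟨t, ht, hs⟩ := exists_exp_small C lam δ hl hδ
  refine ⟨t, ht, fun x v hv => (hh x v hv t ht).trans ?_⟩
  exact mul_le_mul_of_nonneg_right hs (pv_nonneg v)

theorem PP_step (Φ : AnosovFlow d M) {k m : ℕ} (hkm : k + (m + 1) = d) (hm : 1 ≤ m)
    (Ω : M → AlternatingMap ℝ (Eu d) ℝ (Fin k ⊕ Fin (m + 1))) {K m0 : ℝ}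
    (hI : InvF Φ Ω) (hB : BddF Ω K) (hL : LowF Ω m0)
    (hP : PP Φ (Fin k ⊕ Fin 1)) : PP Φ (Fin k) := by
  intro δ hδ
  obtain ⟨hK, hB⟩ := hB
  obtain ⟨hm0, hL⟩ := hL
  obtain ⟨ε, hε, hεδ⟩ : ∃ ε : ℝ, 0 < ε ∧ K * ε ^ (m + 1) ≤ m0 * δ ^ m := by
    refine ⟨min 1 (m0 * δ ^ m / K), by positivity, ?_⟩
    have h1 : (min 1 (m0 * δ ^ m / K)) ^ (m + 1) ≤ min 1 (m0 * δ ^ m / K) :=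
      pow_le_of_le_one (by positivity) (min_le_left _ _) (by omega)
    calc K * (min 1 (m0 * δ ^ m / K)) ^ (m + 1) ≤ K * (m0 * δ ^ m / K) :=
          mul_le_mul_of_nonneg_left (h1.trans (min_le_right _ _)) hK.le
      _ = m0 * δ ^ m := by field_simp
  obtain ⟨t, ht, hP⟩ := hP ε hε
  refine ⟨t, ht, fun x v hv => ?_⟩
  set w : Fin k → Eu d := fun i => mfd (Φ.flow (-t)) x (v i) with hw
  have hinj := mfd_inj Φ (-t) x
  by_cases hvi : LinearIndependent ℝ v
  swap
  · have : ¬ LinearIndependent ℝ w := fun h =>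
      hvi (LinearIndependent.of_comp (mfd (Φ.flow (-t)) x).toLinearMap h)
    rw [pv_of_dep v hvi, pv_of_dep w this]; simp
  have hker : LinearMap.ker (mfd (Φ.flow (-t)) x).toLinearMap = ⊥ := LinearMap.ker_eq_bot.2 hinj
  have hwi : LinearIndependent ℝ w := hvi.map' (mfd (Φ.flow (-t)) x).toLinearMap hker
  obtain ⟨n, hn, hvn⟩ := exists_compl v hvi (m + 1) (by simpa using hkm)
  set S := Submodule.span ℝ (Set.range w) with hS
  let wn : Fin (m + 1) → Eu d := fun j => mfd (Φ.flow (-t)) x (n j)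
  let z : Fin (m + 1) → Eu d := fun j => wn j - S.starProjection (wn j)
  have hz : ∀ j, wn j - z j ∈ S := fun j => by simp [z]
  have hwz : ∀ i j, inner ℝ (w i) (z j) = 0 := fun i j =>
    Submodule.inner_right_of_mem_orthogonal (Submodule.subset_span (Set.mem_range_self i))
      (Submodule.sub_starProjection_mem_orthogonal (wn j))
  -- lower bound
  have h1 : m0 * pv v ≤ |Ω x (Sum.elim v n)| := vol_lower (Ω x) m0 (hL x) v n hn hvn
  have h2 : Ω x (Sum.elim v n) = Ω (Φ.flow (-t) x) (Sum.elim w z) := by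
    rw [← hI (-t) x, ← alt_congr_span _ w wn z hz]
    congr 1
    ext i : 1
    rcases i with i | i <;> rfl
  have h3 : |Ω (Φ.flow (-t) x) (Sum.elim w z)| ≤ (K * ∏ j, ‖z j‖) * pv w := by
    rw [← fixR_apply]
    refine vol_upper _ _ (fun b hb => ?_) w
    have := hB (Φ.flow (-t) x) (Sum.elim b z)
    rw [fixR_apply]
    simpa [hb.1] using this
  -- contraction in dimension k + 1
  have h4 : ∀ j, pv w * ‖z j‖ ≤ ε * pv v := by
    intro j
    have hvj : LinearIndependent ℝ (Sum.elim v (fun _ : Fin 1 => n j)) := by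
      apply Matrix.linearIndependent_of_det_gram_ne_zero
      intro h0
      have h5 := pv_orth_one v (n j) (fun i => hvn i j)
      rw [hn.1, mul_one] at h5
      have := pv_pos v hvi
      rw [← h5, pv, h0] at this
      simp at this
    have hwj : LinearIndependent ℝ (Sum.elim w (fun _ : Fin 1 => wn j)) := by
      have := hvj.map' (mfd (Φ.flow (-t)) x).toLinearMap hker
      have he : (Sum.elim w (fun _ : Fin 1 => wn j)) =
          (mfd (Φ.flow (-t)) x).toLinearMap ∘ Sum.elim v (fun _ : Fin 1 => n j) := by
        ext i : 1
        rcases i with i | i <;> rfl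
      rw [he]
      exact this
    rw [← pv_orth_one w (z j) (fun i => hwz i j), ← pv_add_span w (wn j) (z j) hwj (hz j)]
    obtain ⟨i, hi⟩ := hv
    have h6 := hP x (Sum.elim v (fun _ : Fin 1 => n j)) ⟨Sum.inl i, hi⟩
    rw [pv_orth_one v (n j) (fun i => hvn i j), hn.1, mul_one] at h6
    convert h6 using 2
    ext i : 1
    rcases i with i | i <;> rfl
  have hpv := pv_pos v hvi
  have hpw := pv_pos w hwi
  have h5 : (pv w) ^ (m + 1) * ∏ j, ‖z j‖ ≤ (ε * pv v) ^ (m + 1) := by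
    have := Finset.prod_le_prod (s := Finset.univ) (f := fun j => pv w * ‖z j‖)
      (g := fun _ : Fin (m + 1) => ε * pv v) (fun j _ => by positivity) (fun j _ => h4 j)
    simpa [Finset.prod_mul_distrib] using this
  rw [h2] at h1
  have h6 : m0 * pv v ≤ (K * ∏ j, ‖z j‖) * pv w := h1.trans h3
  have h7 : (m0 * pv v) * pv w ^ m ≤ m0 * δ ^ m * pv v ^ (m + 1) :=
    calc (m0 * pv v) * pv w ^ m ≤ ((K * ∏ j, ‖z j‖) * pv w) * pv w ^ m :=
          mul_le_mul_of_nonneg_right h6 (by positivity)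
      _ = K * ((pv w) ^ (m + 1) * ∏ j, ‖z j‖) := by ring
      _ ≤ K * (ε * pv v) ^ (m + 1) := mul_le_mul_of_nonneg_left h5 hK.le
      _ = (K * ε ^ (m + 1)) * pv v ^ (m + 1) := by ring
      _ ≤ _ := mul_le_mul_of_nonneg_right hεδ (by positivity)
  have h8 : (m0 * pv v) * pv w ^ m ≤ (m0 * pv v) * (δ * pv v) ^ m := by
    calc _ ≤ _ := h7
      _ = _ := by ring
  have h9 := le_of_mul_le_mul_left h8 (by positivity)
  exact le_of_pow_le_pow_left₀ (by omega) (by positivity) h9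

theorem PP_all (Φ : AnosovFlow d M) (h : Φ.Asymmetric) (Ω : Form d M d) {K m0 : ℝ}
    (hI : InvF Φ Ω) (hB : BddF Ω K) (hL : LowF Ω m0) (j k : ℕ) (hjk : k + j + 2 = d) :
    PP Φ (Fin k) := by
  induction j generalizing k with
  | zero => exact (PP_base Φ h).congr (finCongr (by omega))
  | succ j ih =>
    have hkm : k + (j + 2 + 1) = d := by omega
    let e : Fin d ≃ Fin k ⊕ Fin (j + 2 + 1) := (finSumFinEquiv.trans (finCongr hkm)).symm
    refine PP_step Φ hkm (by omega) (fun x => (Ω x).domDomCongr e) (K := K) (m0 := m0) ?_ ?_ ?_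
      ((ih (k + 1) (by omega)).congr finSumFinEquiv.symm)
    · intro t x v
      exact hI t x (fun i => v (e i))
    · refine ⟨hB.1, fun x v => ?_⟩
      have := hB.2 x (fun i => v (e i))
      rwa [e.prod_comp (fun i => ‖v i‖)] at this
    · exact ⟨hL.1, fun x v hv => hL.2 x _ (hv.comp _ e.injective)⟩

/-- A bounded invariant form vanishes on the strong stable bundle. -/
theorem zero_on_stable (Φ : AnosovFlow d M) {ι : Type*} [Fintype ι] [Nonempty ι]
    (η : M → AlternatingMap ℝ (Eu d) ℝ ι) {K : ℝ} (hI : InvF Φ η) (hB : BddF η K)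
    (x : M) (v : ι → Eu d) (hv : ∀ i, v i ∈ Φ.Ess x) : η x v = 0 := by
  by_contra hne
  obtain ⟨hK, hB⟩ := hB
  have hpos : 0 < |η x v| := abs_pos.2 hne
  have hQ : 0 < K * ∏ i, ‖v i‖ := hpos.trans_le (hB x v)
  obtain ⟨t, ht, hs⟩ := exists_exp_small Φ.c Φ.nu (min 1 (|η x v| / (K * ∏ i, ‖v i‖) / 2))
    Φ.nu_pos (by positivity)
  set s := Φ.c * Real.exp (-Φ.nu * t)
  have hs0 : 0 ≤ s := by have := Φ.c_pos; positivity
  have h1 : |η x v| ≤ K * ∏ i, (s * ‖v i‖) := by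
    rw [← hI t x v]
    refine (hB _ _).trans (mul_le_mul_of_nonneg_left ?_ hK.le)
    exact Finset.prod_le_prod (fun _ _ => norm_nonneg _) fun i _ => Φ.contr t ht x _ (hv i)
  rw [Finset.prod_mul_distrib, Finset.prod_const] at h1
  have h2 : s ^ (Finset.univ : Finset ι).card ≤ s :=
    pow_le_of_le_one hs0 (hs.trans (min_le_left _ _)) (by simp)
  have h3 : s ≤ |η x v| / (K * ∏ i, ‖v i‖) / 2 := hs.trans (min_le_right _ _)
  have h4 : |η x v| ≤ |η x v| / (K * ∏ i, ‖v i‖) / 2 * (K * ∏ i, ‖v i‖) := by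
    calc _ ≤ _ := h1
      _ = s ^ (Finset.univ : Finset ι).card * (K * ∏ i, ‖v i‖) := by ring
      _ ≤ _ := mul_le_mul_of_nonneg_right (h2.trans h3) hQ.le
  rw [div_mul_eq_mul_div, div_mul_cancel₀ _ hQ.ne'] at h4
  linarith

theorem zero_of_small {a B : ℝ} (h : ∀ δ : ℝ, 0 < δ → |a| ≤ B * δ) : a = 0 := by
  by_contra hne
  have hpos : 0 < |a| := abs_pos.2 hne
  have h1 := h (|a| / (|B| + 1) / 2) (by positivity)
  have h2 : B * (|a| / (|B| + 1) / 2) ≤ (|B| + 1) * (|a| / (|B| + 1) / 2) :=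
    mul_le_mul_of_nonneg_right (by linarith [le_abs_self B]) (by positivity)
  have h3 : (|B| + 1) * (|a| / (|B| + 1) / 2) = |a| / 2 := by
    have : |B| + 1 ≠ 0 := by positivity
    field_simp
  linarith

/-- Step 1: contraction with unstable vectors vanishes. -/
theorem zero_on_unstable (Φ : AnosovFlow d M) {k : ℕ} (ω : Form d M k) {K : ℝ}
    (hI : InvF Φ ω) (hB : BddF ω K) (hP : PP Φ (Fin k)) (x : M) (v : Fin k → Eu d)
    (hv : ∃ i, v i ∈ Φ.Euu x) : ω x v = 0 := by
  refine zero_of_small (B := K * pv v) fun δ hδ => ?_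
  obtain ⟨t, ht, h⟩ := hP δ hδ
  rw [← hI (-t) x v]
  calc _ ≤ K * pv (fun i => mfd (Φ.flow (-t)) x (v i)) := vol_upper _ K (hB.onb _) _
    _ ≤ K * (δ * pv v) := mul_le_mul_of_nonneg_left (h x v hv) hB.1.le
    _ = _ := by ring

/-- Step 2: if there is an unstable vector at `x`, the form vanishes at `x`. -/
theorem zero_of_unstable (Φ : AnosovFlow d M) {k m : ℕ} (hkm : k + m = d) (hm : 0 < m)
    (ω : Form d M k) {K : ℝ}
    (hI : InvF Φ ω) (hB : BddF ω K) (hPk : PP Φ (Fin k)) (hPm : PP Φ (Fin m))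
    (Ω : M → AlternatingMap ℝ (Eu d) ℝ (Fin k ⊕ Fin m)) {K' m0 : ℝ}
    (hI' : InvF Φ Ω) (hB' : BddF Ω K') (hL : LowF Ω m0)
    (x : M) (u : Eu d) (hu : u ∈ Φ.Euu x) (hu0 : u ≠ 0) (v : Fin k → Eu d) : ω x v = 0 := by
  refine zero_of_small (B := K / m0 * (K' * ∏ i, ‖v i‖)) fun δ hδ => ?_
  obtain ⟨t, ht, hP⟩ := hPm δ hδ
  set y := Φ.flow t x with hy
  let v' : Fin k → Eu d := fun i => mfd (Φ.flow t) x (v i)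
  let u' : Eu d := mfd (Φ.flow t) x u
  have hu' : u' ∈ Φ.Euu y := Φ.inv_uu t x u hu
  have hu'0 : u' ≠ 0 := fun h => hu0 (mfd_inj Φ t x (by simpa [u'] using h))
  let q : Eu d := ‖u'‖⁻¹ • u'
  have hq1 : ‖q‖ = 1 := by
    simp [q, norm_smul, hu'0]
  have hqE : q ∈ Φ.Euu y := Submodule.smul_mem _ _ hu'
  let v'' : Fin k → Eu d := fun i => v' i - inner ℝ q (v' i) • q
  have hd : ∀ i, v' i - v'' i = inner ℝ q (v' i) • q := fun i => by simp [v'']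
  have horth : ∀ i, inner ℝ (v'' i) q = 0 := fun i => by
    simp only [v'']
    rw [inner_sub_left, inner_smul_left, real_inner_self_eq_norm_sq, hq1, real_inner_comm q]
    simp
  have h1 : ω x v = ω y v'' := by
    refine (hI t x v).symm.trans ?_
    refine alt_congr (ω y) (Φ.Euu y) (fun v hv => zero_on_unstable Φ ω hI hB hPk y v hv) v' v'' ?_
    intro i
    rw [hd i]
    exact Submodule.smul_mem _ _ hqE
  have h2 : |ω x v| ≤ K * pv v'' := by
    rw [h1]; exact vol_upper _ K (hB.onb _) _
  have hB0 := hB'.1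
  have hm0 := hL.1
  have hK0 := hB.1
  by_cases hli : LinearIndependent ℝ v''
  swap
  · rw [pv_of_dep _ hli, mul_zero] at h2
    exact h2.trans (mul_nonneg (mul_nonneg (div_nonneg hK0.le hm0.le)
      (mul_nonneg hB0.le (Finset.prod_nonneg fun _ _ => norm_nonneg _))) hδ.le)
  obtain ⟨n, hn, hvn, j, hj⟩ := exists_compl_with v'' hli m (by simpa using hkm) hm q hq1 horth
  have h3 : m0 * pv v'' ≤ |Ω y (Sum.elim v'' n)| := vol_lower (Ω y) m0 (hL.2 y) v'' n hn hvn
  have h4 : Ω y (Sum.elim v'' n) = Ω y (Sum.elim v' n) := by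
    rw [← fixR_apply, ← fixR_apply]
    refine (alt_congr (fixR (Ω y) n) (Submodule.span ℝ (Set.range n)) ?_ v' v'' ?_).symm
    · intro a ha
      rw [fixR_apply, ← fixL_apply]
      have := alt_zero_span ((Ω y).domDomCongr (Equiv.sumComm _ _)) n a ha
      rw [← fixL_apply] at this
      rw [fixL_apply] at this ⊢
      refine Eq.trans ?_ this
      rw [AlternatingMap.domDomCongr_apply]
      congr 1
      ext i : 1
      rcases i with i | i <;> simp
    · intro i
      rw [hd i, ← hj]
      exact Submodule.smul_mem _ _ (Submodule.subset_span (Set.mem_range_self j))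
  have h5 : Ω y (Sum.elim v' n) =
      Ω x (Sum.elim v (fun i => mfd (Φ.flow (-t)) y (n i))) := by
    rw [← hI' (-t) y, hy, flow_neg']
    congr 1
    ext i : 1
    rcases i with i | i
    · exact mfd_neg' Φ t x (v i)
    · rfl
  have h6 : |Ω x (Sum.elim v (fun i => mfd (Φ.flow (-t)) y (n i)))| ≤
      (K' * ∏ i, ‖v i‖) * pv (fun i => mfd (Φ.flow (-t)) y (n i)) := by
    rw [← fixL_apply]
    refine vol_upper _ _ (fun b hb => ?_) _
    have := hB'.2 x (Sum.elim v b)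
    rw [fixL_apply]
    simpa [hb.1] using this
  have h7 : pv (fun i => mfd (Φ.flow (-t)) y (n i)) ≤ δ := by
    have := hP y n ⟨j, hj ▸ hqE⟩
    rwa [pv_orthonormal n hn, mul_one] at this
  rw [h4, h5] at h3
  have h8 : m0 * pv v'' ≤ (K' * ∏ i, ‖v i‖) * δ :=
    (h3.trans h6).trans (mul_le_mul_of_nonneg_left h7 (mul_nonneg hB0.le (Finset.prod_nonneg fun _ _ => norm_nonneg _)))
  calc |ω x v| ≤ K * pv v'' := h2
    _ = K / m0 * (m0 * pv v'') := by field_simp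
    _ ≤ K / m0 * ((K' * ∏ i, ‖v i‖) * δ) := mul_le_mul_of_nonneg_left h8 (div_nonneg hK0.le hm0.le)
    _ = _ := by ring

/-- Step 3: the case without unstable directions. -/
theorem zero_of_no_unstable (Φ : AnosovFlow d M) {k m : ℕ} (hkm : k + m = d) (hm : 0 < m)
    (hk : 0 < k) (ω : Form d M k) {K : ℝ} (hI : InvF Φ ω) (hB : BddF ω K)
    (Ω : M → AlternatingMap ℝ (Eu d) ℝ (Fin k ⊕ Fin m)) {K' m0 : ℝ}
    (hI' : InvF Φ Ω) (hB' : BddF Ω K') (hL : LowF Ω m0)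
    (x : M) (hx : Φ.Euu x = ⊥) (i0 : Fin k) (v : Fin k → Eu d) (hv0 : v i0 = Φ.gen x)
    (hv : ∀ i, i ≠ i0 → v i ∈ Φ.Ess x) : ω x v = 0 := by
  have : Nonempty (Fin k) := ⟨i0⟩
  refine zero_of_small (B := K / m0 * (K' * ∏ i, ‖v i‖)) fun δ hδ => ?_
  obtain ⟨t, ht, hs⟩ := exists_exp_small Φ.c Φ.nu (min 1 δ) Φ.nu_pos (by positivity)
  set s := Φ.c * Real.exp (-Φ.nu * t)
  have hs0 : 0 ≤ s := by have := Φ.c_pos; positivity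
  set y := Φ.flow (-t) x with hy
  let L : Eu d →ₗ[ℝ] Eu d := (mfd (Φ.flow (-t)) x).toLinearMap
  let w : Fin k → Eu d := fun i => L (v i)
  let E : Submodule ℝ (Eu d) := (Φ.Ess x).map L
  have hE : ∀ a ∈ E, a ∈ Φ.Ess y := by
    rintro _ ⟨a, ha, rfl⟩
    exact Φ.inv_ss (-t) x a ha
  have hdec : ∀ a : Eu d, ∃ r : ℝ, a - r • w i0 ∈ E := by
    intro a
    have h1 : mfd (Φ.flow t) y a ∈ Φ.Ec x ⊔ Φ.Ess x := by
      have := Φ.sup_eq_top x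
      rw [hx, bot_sup_eq] at this
      rw [this]; trivial
    obtain ⟨b, hb, c, hc, hbc⟩ := Submodule.mem_sup.1 h1
    rw [Φ.Ec_eq, Submodule.mem_span_singleton] at hb
    obtain ⟨r, rfl⟩ := hb
    refine ⟨r, c, hc, ?_⟩
    have h2 : L (mfd (Φ.flow t) y a) = a := by
      have := mfd_neg' Φ t y a
      rw [hy, flow_neg] at this
      exact this
    rw [← hbc, map_add, map_smul] at h2
    rw [← h2]
    simp [w, hv0]
  have hwE : ∀ i, i ≠ i0 → w i ∈ E := fun i hi => ⟨v i, hv i hi, rfl⟩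
  let a : Eu d := w i0 - E.starProjection (w i0)
  have haE : w i0 - a ∈ E := by simp [a]
  have hao : a ∈ Eᗮ := Submodule.sub_starProjection_mem_orthogonal (w i0)
  let w' : Fin k → Eu d := Function.update w i0 a
  have hup : ∀ (f : AlternatingMap ℝ (Eu d) ℝ (Fin k)),
      (∀ b : Fin k → Eu d, (∀ i, b i ∈ E) → f b = 0) → f w = f w' := by
    intro f hf
    have h1 : f (Function.update w i0 (w i0 - a)) = 0 := by
      apply hf
      intro i
      by_cases hi : i = i0
      · subst hi; simpa using haE
      · simpa [hi] using hwE i hi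
    rw [AlternatingMap.map_update_sub, sub_eq_zero] at h1
    simpa [w'] using h1
  have h1 : ω x v = ω y w' := by
    rw [← hI (-t) x v]
    exact hup (ω y) fun b hb => zero_on_stable Φ ω hI hB y b fun i => hE _ (hb i)
  have h2 : |ω x v| ≤ K * pv w' := by
    rw [h1]; exact vol_upper _ K (hB.onb _) _
  have hB0 := hB'.1
  have hm0 := hL.1
  have hK0 := hB.1
  by_cases hli : LinearIndependent ℝ w'
  swap
  · rw [pv_of_dep _ hli, mul_zero] at h2
    exact h2.trans (mul_nonneg (mul_nonneg (div_nonneg hK0.le hm0.le)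
      (mul_nonneg hB0.le (Finset.prod_nonneg fun _ _ => norm_nonneg _))) hδ.le)
  have ha0 : a ≠ 0 := by
    have := hli.ne_zero i0
    simpa [w'] using this
  obtain ⟨n, hn, hvn⟩ := exists_compl w' hli m (by simpa using hkm)
  have hnE : ∀ j, n j ∈ E := by
    intro j
    obtain ⟨r, hr⟩ := hdec (n j)
    have h3 : n j - r • a ∈ E := by
      have : n j - r • a = (n j - r • w i0) + r • (w i0 - a) := by
        rw [smul_sub r (w i0) a, sub_add_sub_cancel]
      rw [this]
      exact E.add_mem hr (E.smul_mem _ haE)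
    have h4 : inner ℝ a (n j - r • a) = 0 := by
      rw [real_inner_comm]
      exact Submodule.inner_right_of_mem_orthogonal h3 hao
    have h5 : inner ℝ a (n j) = 0 := by
      have := hvn i0 j
      simpa [w'] using this
    rw [inner_sub_right, h5, inner_smul_right, real_inner_self_eq_norm_sq, zero_sub,
      neg_eq_zero, mul_eq_zero] at h4
    rcases h4 with h4 | h4
    · simpa [h4] using h3
    · simp [ha0] at h4
  have h3 : m0 * pv w' ≤ |Ω y (Sum.elim w' n)| := vol_lower (Ω y) m0 (hL.2 y) w' n hn hvn
  have h4 : Ω y (Sum.elim w' n) = Ω y (Sum.elim w n) := by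
    rw [← fixR_apply, ← fixR_apply]
    refine (hup (fixR (Ω y) n) fun b hb => ?_).symm
    rw [fixR_apply]
    refine zero_on_stable Φ Ω hI' hB' y _ ?_
    rintro (i | i)
    · exact hE _ (hb i)
    · exact hE _ (hnE i)
  have h5 : Ω y (Sum.elim w n) = Ω x (Sum.elim v (fun i => mfd (Φ.flow t) y (n i))) := by
    rw [← hI' t y, hy, flow_neg]
    congr 1
    ext i : 1
    rcases i with i | i
    · exact mfd_neg Φ t x (v i)
    · rfl
  have h6 : |Ω x (Sum.elim v (fun i => mfd (Φ.flow t) y (n i)))| ≤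
      (K' * ∏ i, ‖v i‖) * δ := by
    have h7 := hB'.2 x (Sum.elim v (fun i => mfd (Φ.flow t) y (n i)))
    rw [Fintype.prod_sum_type, ← mul_assoc] at h7
    refine h7.trans (mul_le_mul_of_nonneg_left ?_ (by simp only [Sum.elim_inl]; positivity))
    have h8 : ∏ j, ‖mfd (Φ.flow t) y (n j)‖ ≤ ∏ _j : Fin m, s :=
      Finset.prod_le_prod (fun _ _ => norm_nonneg _) fun j _ => by
        have := Φ.contr t ht y (n j) (hE _ (hnE j))
        rwa [hn.1, mul_one] at this
    refine h8.trans ?_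
    rw [Finset.prod_const]
    exact (pow_le_of_le_one hs0 (hs.trans (min_le_left _ _)) (by simp; omega)).trans
      (hs.trans (min_le_right _ _))
  rw [h4, h5] at h3
  calc |ω x v| ≤ K * pv w' := h2
    _ = K / m0 * (m0 * pv w') := by field_simp
    _ ≤ K / m0 * ((K' * ∏ i, ‖v i‖) * δ) :=
        mul_le_mul_of_nonneg_left (h3.trans h6) (by positivity)
    _ = _ := by ring

end Dyn

/-- **Triviality of invariant forms in intermediate degrees** (Proposition
`prop:invariant`(c)).  If `Φ` is a smooth volume-preserving asymmetric Anosov flow with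
generator `X` on a closed `n`-manifold `M` and `2 ≤ k ≤ n - 2`, then the only continuous
`k`-form `ω` with continuous `L_X ω` satisfying `L_X ω = 0` is `ω = 0`. -/
theorem invariant_forms_intermediate_degrees_trivial
    {d : ℕ} {M : Type*} [TopologicalSpace M] [ChartedSpace (Eu d) M]
    [IsManifold (𝓡 d) (⊤ : ℕ∞) M] [CompactSpace M] [ConnectedSpace M]
    (Φ : AnosovFlow d M) (hasym : Φ.Asymmetric)
    (Ω : Form d M d) (hΩ : Φ.PreservesVol Ω)
    {k : ℕ} (hk₁ : 2 ≤ k) (hk₂ : k ≤ d - 2)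
    (ω : Form d M k) (hω : ContForm ω) (hinv : IsLieDeriv Φ.flow ω 0) :
    ω = 0 := by
  obtain ⟨hΩs, hΩ0, hΩp⟩ := hΩ
  have hΩc : ContForm Ω := fun v => (hΩs v).continuous
  have hIΩ : InvF Φ Ω := fun t x v =>
    congrArg (fun η : AltF d d => η v) (congrFun (hΩp t) x)
  obtain ⟨K', hBΩ⟩ := bddF_of_cont Ω hΩc
  obtain ⟨m0, hLΩ⟩ := lowF_of_cont Ω hΩc hΩ0
  have hI := invF_of_lie Φ ω hinv
  obtain ⟨K, hB⟩ := bddF_of_cont ω hω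
  obtain ⟨m, hkm⟩ : ∃ m, k + m = d := ⟨d - k, by omega⟩
  have hPk : PP Φ (Fin k) := PP_all Φ hasym Ω hIΩ hBΩ hLΩ (d - 2 - k) k (by omega)
  have hPm : PP Φ (Fin m) := PP_all Φ hasym Ω hIΩ hBΩ hLΩ (d - 2 - m) m (by omega)
  let e : Fin d ≃ Fin k ⊕ Fin m := (finSumFinEquiv.trans (finCongr hkm)).symm
  let Ω' : M → AlternatingMap ℝ (Eu d) ℝ (Fin k ⊕ Fin m) := fun x => (Ω x).domDomCongr e
  have hI' : InvF Φ Ω' := fun t x v => hIΩ t x (fun i => v (e i))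
  have hB' : BddF Ω' K' := by
    refine ⟨hBΩ.1, fun x v => ?_⟩
    have := hBΩ.2 x (fun i => v (e i))
    rwa [e.prod_comp (fun i => ‖v i‖)] at this
  have hL' : LowF Ω' m0 := ⟨hLΩ.1, fun x v hv => hLΩ.2 x _ (hv.comp _ e.injective)⟩
  funext x
  by_cases hx : Φ.Euu x = ⊥
  · have hspan : (⊤ : Submodule ℝ (Eu d)) ≤
        Submodule.span ℝ ({Φ.gen x} ∪ (Φ.Ess x : Set (Eu d))) := by
      have h1 := Φ.sup_eq_top x
      rw [hx, bot_sup_eq, Φ.Ec_eq] at h1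
      rw [Submodule.span_union, Submodule.span_eq, h1]
    have hsub := Module.Basis.ofSpan_subset hspan
    refine Module.Basis.ext_alternating (Module.Basis.ofSpan hspan) fun r hr => ?_
    have hmem : ∀ i, Module.Basis.ofSpan hspan (r i) = Φ.gen x ∨
        Module.Basis.ofSpan hspan (r i) ∈ Φ.Ess x := fun i => by
      have := hsub (Set.mem_range_self (r i))
      simpa using this
    change ω x _ = 0
    by_cases hall : ∀ i, Module.Basis.ofSpan hspan (r i) ∈ Φ.Ess x
    · have : Nonempty (Fin k) := ⟨⟨0, by omega⟩⟩
      exact zero_on_stable Φ ω hI hB x _ hall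
    · push Not at hall
      obtain ⟨i0, hi0⟩ := hall
      have hi0' := (hmem i0).resolve_right hi0
      refine zero_of_no_unstable Φ hkm (by omega) (by omega) ω hI hB Ω' hI' hB' hL' x hx i0 _
        hi0' fun i hi => (hmem i).resolve_left fun h => hi ?_
      exact hr ((Module.Basis.ofSpan hspan).injective (h.trans hi0'.symm))
  · obtain ⟨u, hu, hu0⟩ := Submodule.exists_mem_ne_zero_of_ne_bot hx
    ext v
    exact zero_of_unstable Φ hkm (by omega) ω hI hB hPk hPm Ω' hI' hB' hL' x u hu hu0 v
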